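/- Let f ~ N(μ_f, Σ_f) and g ~ N(μ_g, Σ_g) be d-variate Gaussian densities with commuting covariance matrices, and let C = cos(D), S = sin(D) with D = t·√(Σ_f⁻¹Σ_g⁻¹) for some t > 0 with 0 < C < I. Then for any Gaussian density h ~ N(μ_h, Σ_h), the GHMC image T h(q) = ∫ h(Q(q,p)) g(P(q,p)) dp is again a Gaussian density N(μ', Σ') with μ' - μ_f = C(μ_h - μ_f) and Σ' - Σ_f = C(Σ_h - Σ_f)C. -/

import Mathlib

open Matrix MeasureTheory Real

noncomputable def mcos {d : ℕ} (M : Matrix (Fin d) (Fin d) ℝ) : Matrix (Fin d) (Fin d) ℝ :=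
  ∑' n : ℕ, ((-1 : ℝ) ^ n / (Nat.factorial (2 * n) : ℝ)) • M ^ (2 * n)

noncomputable def msin {d : ℕ} (M : Matrix (Fin d) (Fin d) ℝ) : Matrix (Fin d) (Fin d) ℝ :=
  ∑' n : ℕ, ((-1 : ℝ) ^ n / (Nat.factorial (2 * n + 1) : ℝ)) • M ^ (2 * n + 1)

/-- The density of the `d`-variate Gaussian `N(μ, Σ)`. -/
noncomputable def gaussPdf {d : ℕ} (μ : Fin d → ℝ) (Sig : Matrix (Fin d) (Fin d) ℝ)
    (q : Fin d → ℝ) : ℝ :=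
  (2 * π) ^ (-(d : ℝ) / 2) * Sig.det ^ (-(1 : ℝ) / 2) *
    Real.exp (-(1 / 2) * ((q - μ) ⬝ᵥ (Sig⁻¹ *ᵥ (q - μ))))


lemma exists_diag {d : ℕ} {M : Matrix (Fin d) (Fin d) ℝ} (hM : M.PosDef) :
    ∃ (U : Matrix (Fin d) (Fin d) ℝ) (a : Fin d → ℝ), U * Uᵀ = 1 ∧ Uᵀ * U = 1 ∧ (∀ i, 0 < a i) ∧
      M = U * diagonal a * Uᵀ := by
  have h := hM.1.spectral_theorem
  refine ⟨hM.1.eigenvectorUnitary, hM.1.eigenvalues, ?_, ?_, hM.eigenvalues_pos, ?_⟩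
  · have := Unitary.coe_mul_star_self hM.1.eigenvectorUnitary
    simpa [star_eq_conjTranspose] using this
  · have := Unitary.coe_star_mul_self hM.1.eigenvectorUnitary
    simpa [star_eq_conjTranspose] using this
  · rw [Unitary.conjStarAlgAut_apply] at h
    simpa [star_eq_conjTranspose, Function.comp_def] using h

lemma comm_of_sq {d : ℕ} {A X : Matrix (Fin d) (Fin d) ℝ} (hA : A.PosDef)
    (h : Commute (A * A) X) : Commute A X := by
  obtain ⟨U, a, h1, h2, ha, rfl⟩ := exists_diag hA
  have e1 : Uᵀ * ((U * diagonal a * Uᵀ) * (U * diagonal a * Uᵀ) * X) * U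
      = diagonal a * (diagonal a * (Uᵀ * X * U)) := by
    calc _ = (Uᵀ * U) * diagonal a * (Uᵀ * U) * diagonal a * (Uᵀ * X * U) := by noncomm_ring
      _ = _ := by rw [h2]; noncomm_ring
  have e2 : Uᵀ * (X * ((U * diagonal a * Uᵀ) * (U * diagonal a * Uᵀ))) * U
      = (Uᵀ * X * U) * diagonal a * diagonal a := by
    calc _ = (Uᵀ * X * U) * diagonal a * (Uᵀ * U) * diagonal a * (Uᵀ * U) := by noncomm_ring
      _ = _ := by rw [h2]; noncomm_ring
  rw [h.eq, e2] at e1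
  set Y := Uᵀ * X * U with hY
  have hX : X = U * Y * Uᵀ := by
    calc X = (U * Uᵀ) * X * (U * Uᵀ) := by rw [h1]; simp
      _ = _ := by rw [hY]; noncomm_ring
  have hc : diagonal a * Y = Y * diagonal a := by
    ext i j
    have := congrFun (congrFun e1 i) j
    simp only [mul_diagonal, diagonal_mul] at this ⊢
    have h3 : (a i + a j) * (a i * Y i j - Y i j * a j) = 0 := by linarith
    have h4 : a i + a j ≠ 0 := (add_pos (ha i) (ha j)).ne'
    have := (mul_eq_zero.1 h3).resolve_left h4
    linarith
  rw [hX]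
  change U * diagonal a * Uᵀ * (U * Y * Uᵀ) = U * Y * Uᵀ * (U * diagonal a * Uᵀ)
  calc _ = U * diagonal a * (Uᵀ * U) * Y * Uᵀ := by noncomm_ring
    _ = U * (diagonal a * Y) * Uᵀ := by rw [h2]; noncomm_ring
    _ = U * Y * (Uᵀ * U) * diagonal a * Uᵀ := by rw [h2, hc]; noncomm_ring
    _ = _ := by noncomm_ring

lemma conj_pow' {d : ℕ} {U : Matrix (Fin d) (Fin d) ℝ} (h1 : U * Uᵀ = 1) (h2 : Uᵀ * U = 1)
    (a : Fin d → ℝ) (n : ℕ) :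
    (U * diagonal a * Uᵀ) ^ n = U * diagonal (a ^ n) * Uᵀ := by
  induction n with
  | zero => simp [h1]
  | succ n ih =>
    rw [pow_succ, ih]
    calc _ = U * diagonal (a ^ n) * (Uᵀ * U) * diagonal a * Uᵀ := by noncomm_ring
      _ = U * (diagonal (a ^ n) * diagonal a) * Uᵀ := by rw [h2]; noncomm_ring
      _ = _ := by rw [diagonal_mul_diagonal]; congr

lemma conj_hasSum {d : ℕ} {U : Matrix (Fin d) (Fin d) ℝ}
    (h1 : U * Uᵀ = 1) (h2 : Uᵀ * U = 1) (a : Fin d → ℝ) (c : ℕ → ℝ) (k : ℕ → ℕ) (F : ℝ → ℝ)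
    (hF : ∀ x, HasSum (fun n => c n * x ^ (k n)) (F x)) :
    HasSum (fun n => c n • (U * diagonal a * Uᵀ) ^ (k n)) (U * diagonal (fun i => F (a i)) * Uᵀ) := by
  have h : HasSum (fun n => fun i => c n * (a i) ^ (k n)) (fun i => F (a i)) :=
    Pi.hasSum.2 fun i => hF (a i)
  have := (h.matrix_diagonal.mul_left U).mul_right Uᵀ
  have e : (fun n => c n • (U * diagonal a * Uᵀ) ^ (k n))
      = fun n => U * (diagonal fun i => c n * a i ^ k n) * Uᵀ := by
    funext n
    rw [conj_pow' h1 h2, ← smul_mul_assoc, ← mul_smul_comm, ← diagonal_smul]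
    rfl
  rw [e]
  exact this

lemma cos_sin_sq {d : ℕ} {M : Matrix (Fin d) (Fin d) ℝ} (hM : M.PosDef) :
    mcos M * mcos M + msin M * msin M = 1 := by
  obtain ⟨U, a, h1, h2, ha, rfl⟩ := exists_diag hM
  have hc : mcos (U * diagonal a * Uᵀ) = U * diagonal (fun i => Real.cos (a i)) * Uᵀ := by
    refine (conj_hasSum h1 h2 a _ _ Real.cos fun x => ?_).tsum_eq
    convert Real.hasSum_cos x using 2; ring
  have hs : msin (U * diagonal a * Uᵀ) = U * diagonal (fun i => Real.sin (a i)) * Uᵀ := by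
    refine (conj_hasSum h1 h2 a _ _ Real.sin fun x => ?_).tsum_eq
    convert Real.hasSum_sin x using 2; ring
  rw [hc, hs]
  calc _ = U * (diagonal (fun i => Real.cos (a i)) * (Uᵀ * U) * diagonal (fun i => Real.cos (a i))
        + diagonal (fun i => Real.sin (a i)) * (Uᵀ * U) * diagonal (fun i => Real.sin (a i))) * Uᵀ := by
        noncomm_ring
    _ = 1 := by
      rw [h2, mul_one, mul_one, diagonal_mul_diagonal, diagonal_mul_diagonal, diagonal_add]
      simp [← sq, h1]

lemma commute_mcos {d : ℕ} {M X : Matrix (Fin d) (Fin d) ℝ} (h : Commute X M) :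
    Commute X (mcos M) :=
  Commute.tsum_right _ fun _ => (h.pow_right _).smul_right _

lemma commute_msin {d : ℕ} {M X : Matrix (Fin d) (Fin d) ℝ} (h : Commute X M) :
    Commute X (msin M) :=
  Commute.tsum_right _ fun _ => (h.pow_right _).smul_right _

lemma msin_transpose {d : ℕ} {M : Matrix (Fin d) (Fin d) ℝ} (h : Mᵀ = M) :
    (msin M)ᵀ = msin M := by
  simp only [msin, transpose_tsum, transpose_smul, transpose_pow, h]

lemma integral_comp_mulVec {d : ℕ} {M : Matrix (Fin d) (Fin d) ℝ} (hM : M.det ≠ 0)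
    (f : (Fin d → ℝ) → ℝ) :
    ∫ z, f (M *ᵥ z) = |M.det|⁻¹ * ∫ z, f z := by
  have hme : MeasurableEmbedding (toLin' M) := by
    have hinj : Function.Injective (toLin' M) := by
      intro x y h
      simp only [toLin'_apply] at h
      have h' : IsUnit M.det := isUnit_iff_ne_zero.2 hM
      simpa [mulVec_mulVec, nonsing_inv_mul _ h'] using congrArg (fun v => M⁻¹ *ᵥ v) h
    exact (LinearMap.continuous_on_pi _).measurableEmbedding hinj
  have := hme.integral_map (μ := volume) f
  rw [Real.map_matrix_volume_pi_eq_smul_volume_pi hM, integral_smul_measure] at this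
  simp only [toLin'_apply] at this
  rw [← this, ENNReal.toReal_ofReal (abs_nonneg _), abs_inv, smul_eq_mul]

lemma gauss_integral {d : ℕ} {M : Matrix (Fin d) (Fin d) ℝ} (hM : M.PosDef) :
    ∫ z : Fin d → ℝ, Real.exp (-(1 / 2) * (z ⬝ᵥ (M *ᵥ z)))
      = (2 * π) ^ ((d : ℝ) / 2) * M.det ^ (-(1 : ℝ) / 2) := by
  obtain ⟨U, a, h1, h2, ha, hMd⟩ := exists_diag hM
  set R : Matrix (Fin d) (Fin d) ℝ := diagonal (fun i => √(a i)) * Uᵀ with hR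
  have hRM : Rᵀ * R = M := by
    rw [hR, transpose_mul, transpose_transpose, diagonal_transpose, hMd]
    calc _ = U * (diagonal (fun i => √(a i)) * diagonal (fun i => √(a i))) * Uᵀ := by noncomm_ring
      _ = _ := by
        rw [diagonal_mul_diagonal]; congr 3; ext i; exact Real.mul_self_sqrt (ha i).le
  have hdet : R.det ^ 2 = M.det := by
    have := congrArg Matrix.det hRM
    rw [det_mul, det_transpose] at this
    rw [sq, this]
  have hpos := hM.det_pos
  have hR0 : R.det ≠ 0 := by rintro h; rw [h] at hdet; simp at hdet; linarith
  have hq : ∀ z, z ⬝ᵥ (M *ᵥ z) = ∑ i, (R *ᵥ z) i ^ 2 := by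
    intro z
    rw [← hRM, ← mulVec_mulVec, dotProduct_mulVec, vecMul_transpose]
    simp [dotProduct, sq]
  simp_rw [hq]
  rw [integral_comp_mulVec hR0 (fun z => Real.exp (-(1 / 2) * ∑ i, z i ^ 2))]
  simp_rw [Finset.mul_sum, Real.exp_sum]
  rw [integral_fintype_prod_volume_eq_pow (fun x : ℝ => Real.exp (-(1/2) * x ^ 2)), integral_gaussian]
  have e1 : |R.det|⁻¹ = M.det ^ (-(1 : ℝ) / 2) := by
    rw [← Real.sqrt_sq_eq_abs, hdet, Real.sqrt_eq_rpow, ← Real.rpow_neg hpos.le]; congr 1; ring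
  have e2 : √(π / (1 / 2)) ^ Fintype.card (Fin d) = (2 * π) ^ ((d : ℝ) / 2) := by
    rw [Fintype.card_fin, Real.sqrt_eq_rpow, ← Real.rpow_natCast, ← Real.rpow_mul (by positivity)]
    congr 1 <;> ring
  rw [e1, e2, mul_comm]

lemma gauss_conv {d : ℕ} {Sh Sg : Matrix (Fin d) (Fin d) ℝ} (hSh : Sh.PosDef) (hSg : Sg.PosDef)
    (L : Matrix (Fin d) (Fin d) ℝ) (w : Fin d → ℝ) :
    ∫ z : Fin d → ℝ, gaussPdf 0 Sh (w + L *ᵥ z) * gaussPdf 0 Sg z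
      = gaussPdf 0 (Sh + L * Sg * Lᵀ) w := by
  set H := Sh⁻¹ with hH
  set G := Sg⁻¹ with hG
  have hHp : H.PosDef := hSh.inv
  have hGp : G.PosDef := hSg.inv
  have hHt : Hᵀ = H := by simpa using hHp.1.eq
  have hps : (Lᵀ * H * L).PosSemidef := by
    simpa using hHp.posSemidef.conjTranspose_mul_mul_same L
  have hps2 : (L * Sg * Lᵀ).PosSemidef := by
    simpa using hSg.posSemidef.mul_mul_conjTranspose_same L
  set M := G + Lᵀ * H * L with hM
  have hMp : M.PosDef := hGp.add_posSemidef hps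
  have hMt : Mᵀ = M := by simpa using hMp.1.eq
  have hMu : IsUnit M.det := isUnit_iff_ne_zero.2 hMp.det_pos.ne'
  have hTp : (Sh + L * Sg * Lᵀ).PosDef := hSh.add_posSemidef hps2
  have hW : (Sh + L * Sg * Lᵀ)⁻¹ = H - H * L * M⁻¹ * Lᵀ * H :=
    add_mul_mul_inv_eq_sub _ _ _ _ hSh.isUnit hSg.isUnit hMp.isUnit
  have hdet : (Sh + L * Sg * Lᵀ).det = Sh.det * Sg.det * M.det := by
    have e : Sg * M = 1 + Sg * Lᵀ * Sh⁻¹ * L := by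
      rw [hM, mul_add, hG, mul_nonsing_inv _ (isUnit_iff_ne_zero.2 hSg.det_pos.ne')]
      simp only [mul_assoc, hH]
    rw [mul_assoc L, det_add_mul _ _ (isUnit_iff_ne_zero.2 hSh.det_pos.ne'), mul_assoc Sh.det,
      ← det_mul Sg, e]
  set v := (Lᵀ * H) *ᵥ w with hv
  set b := M⁻¹ *ᵥ v with hb
  have hMb : M *ᵥ b = v := by rw [hb, mulVec_mulVec, mul_nonsing_inv _ hMu, one_mulVec]
  have hbM : ∀ z, b ⬝ᵥ (M *ᵥ z) = z ⬝ᵥ v := by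
    intro z
    rw [dotProduct_mulVec, ← mulVec_transpose, hMt, hMb, dotProduct_comm]
  have hwL : ∀ z, w ⬝ᵥ (H *ᵥ (L *ᵥ z)) = z ⬝ᵥ v := by
    intro z
    rw [mulVec_mulVec, dotProduct_mulVec, ← mulVec_transpose, transpose_mul, hHt, dotProduct_comm]
  have hLw : ∀ z, (L *ᵥ z) ⬝ᵥ (H *ᵥ w) = z ⬝ᵥ v := by
    intro z
    rw [hv, ← mulVec_mulVec, dotProduct_mulVec z, vecMul_transpose]
  have hexp : ∀ z, (w + L *ᵥ z) ⬝ᵥ (H *ᵥ (w + L *ᵥ z)) + z ⬝ᵥ (G *ᵥ z)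
      = (z + b) ⬝ᵥ (M *ᵥ (z + b)) + w ⬝ᵥ ((Sh + L * Sg * Lᵀ)⁻¹ *ᵥ w) := by
    intro z
    have e1 : (H * L * M⁻¹ * Lᵀ * H) *ᵥ w = H *ᵥ (L *ᵥ b) := by
      simp only [hb, hv, mulVec_mulVec, mul_assoc]
    have e2 : z ⬝ᵥ (M *ᵥ z) = z ⬝ᵥ (G *ᵥ z) + (L *ᵥ z) ⬝ᵥ (H *ᵥ (L *ᵥ z)) := by
      rw [hM, add_mulVec, dotProduct_add, mul_assoc, ← mulVec_mulVec, dotProduct_mulVec z Lᵀ,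
        vecMul_transpose, ← mulVec_mulVec]
    rw [hW, sub_mulVec, e1]
    simp only [mulVec_add, dotProduct_add, add_dotProduct, dotProduct_sub, hwL, hLw, hMb, hbM, e2]
    ring
  have hint : ∀ z, gaussPdf 0 Sh (w + L *ᵥ z) * gaussPdf 0 Sg z
      = ((2 * π) ^ (-(d : ℝ) / 2) * Sh.det ^ (-(1 : ℝ) / 2) *
          ((2 * π) ^ (-(d : ℝ) / 2) * Sg.det ^ (-(1 : ℝ) / 2)) *
          Real.exp (-(1 / 2) * (w ⬝ᵥ ((Sh + L * Sg * Lᵀ)⁻¹ *ᵥ w)))) *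
        Real.exp (-(1 / 2) * ((z + b) ⬝ᵥ (M *ᵥ (z + b)))) := by
    intro z
    simp only [gaussPdf, sub_zero]
    rw [mul_mul_mul_comm, ← Real.exp_add, ← mul_add, hexp, mul_assoc (_ * _) (Real.exp _),
      ← Real.exp_add, ← mul_add, add_comm]
  simp_rw [hint]
  rw [integral_const_mul,
    integral_add_right_eq_self (fun z => Real.exp (-(1 / 2) * (z ⬝ᵥ (M *ᵥ z)))) b,
    gauss_integral hMp, gaussPdf, hdet, sub_zero,
    Real.mul_rpow (mul_pos hSh.det_pos hSg.det_pos).le hMp.det_pos.le,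
    Real.mul_rpow hSh.det_pos.le hSg.det_pos.le]
  have hpi : (2 * π) ^ (-(d : ℝ) / 2) * (2 * π) ^ ((d : ℝ) / 2) = 1 := by
    rw [← Real.rpow_add (by positivity), neg_div, neg_add_cancel, Real.rpow_zero]
  linear_combination ((2 * π) ^ (-(d : ℝ) / 2) * Sh.det ^ (-(1 : ℝ) / 2) *
          Sg.det ^ (-(1 : ℝ) / 2) * M.det ^ (-(1 : ℝ) / 2) *
          Real.exp (-(1 / 2) * (w ⬝ᵥ ((Sh + L * Sg * Lᵀ)⁻¹ *ᵥ w)))) * hpi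

lemma gauss_scale {d : ℕ} {C T : Matrix (Fin d) (Fin d) ℝ} (hC : C.PosDef) (hT : T.PosDef)
    (v : Fin d → ℝ) :
    |C.det|⁻¹ * gaussPdf 0 T (C⁻¹ *ᵥ v) = gaussPdf 0 (C * T * C) v := by
  have hCt : C⁻¹ᵀ = C⁻¹ := by simpa using hC.inv.1.eq
  have hc := hC.det_pos
  have e1 : (C⁻¹ *ᵥ v) ⬝ᵥ (T⁻¹ *ᵥ (C⁻¹ *ᵥ v)) = v ⬝ᵥ ((C * T * C)⁻¹ *ᵥ v) := by
    rw [Matrix.mul_inv_rev, Matrix.mul_inv_rev, ← mulVec_mulVec, ← mulVec_mulVec, dotProduct_mulVec v,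
      ← mulVec_transpose, hCt]
  have e2 : (C * T * C).det ^ (-(1 : ℝ) / 2) = |C.det|⁻¹ * T.det ^ (-(1 : ℝ) / 2) := by
    rw [det_mul, det_mul, show C.det * T.det * C.det = C.det ^ 2 * T.det by ring,
      Real.mul_rpow (by positivity) hT.det_pos.le, abs_of_pos hc, ← Real.rpow_natCast,
      ← Real.rpow_mul hc.le, ← Real.rpow_neg_one]
    norm_num
  simp only [gaussPdf, sub_zero]
  rw [e1, e2]
  ring

lemma gaussPdf_sub {d : ℕ} (μ : Fin d → ℝ) (T : Matrix (Fin d) (Fin d) ℝ) (q : Fin d → ℝ) :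
    gaussPdf μ T q = gaussPdf 0 T (q - μ) := by
  simp [gaussPdf]

theorem ghmc_gaussian_invariance
    {d : ℕ} (Sf Sg Sh : Matrix (Fin d) (Fin d) ℝ)
    (hSf : Sf.PosDef) (hSg : Sg.PosDef) (hSh : Sh.PosDef)
    (hcomm : Sf * Sg = Sg * Sf)
    (μf μg μh : Fin d → ℝ)
    (A : Matrix (Fin d) (Fin d) ℝ) (hA : A.PosDef) (hAsq : A * A = Sf * Sg⁻¹)
    (B : Matrix (Fin d) (Fin d) ℝ) (hB : B.PosDef) (hBsq : B * B = Sf⁻¹ * Sg⁻¹)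
    (t : ℝ) (ht : 0 < t)
    (C S : Matrix (Fin d) (Fin d) ℝ)
    (hCdef : C = mcos (t • B)) (hSdef : S = msin (t • B))
    (hCpos : C.PosDef) (hCltI : ((1 : Matrix (Fin d) (Fin d) ℝ) - C).PosDef)
    (Q P : (Fin d → ℝ) → (Fin d → ℝ) → Fin d → ℝ)
    (hQ : Q = fun q p => μf + C *ᵥ (q - μf) + A *ᵥ (S *ᵥ (p - μg)))
    (hP : P = fun q p => μg - A⁻¹ *ᵥ (S *ᵥ (q - μf)) + C *ᵥ (p - μg)) :
    ∀ q : Fin d → ℝ,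
      ∫ p : Fin d → ℝ, gaussPdf μh Sh (Q q p) * gaussPdf μg Sg (P q p)
        = gaussPdf (μf + C *ᵥ (μh - μf)) (Sf + C * (Sh - Sf) * C) q := by
  have hu : ∀ {X : Matrix (Fin d) (Fin d) ℝ}, X.PosDef → IsUnit X.det := fun h =>
    isUnit_iff_ne_zero.2 h.det_pos.ne'
  have tr : ∀ {X : Matrix (Fin d) (Fin d) ℝ}, X.PosDef → Xᵀ = X := fun h => by
    simpa using h.1.eq
  have cinv : ∀ {X Y : Matrix (Fin d) (Fin d) ℝ}, Y.PosDef → Commute X Y → Commute X Y⁻¹ := by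
    intro X Y hY h
    change X * Y⁻¹ = Y⁻¹ * X
    calc X * Y⁻¹ = Y⁻¹ * Y * X * Y⁻¹ := by rw [nonsing_inv_mul _ (hu hY), one_mul]
      _ = Y⁻¹ * (X * Y) * Y⁻¹ := by rw [h.eq, mul_assoc Y⁻¹]
      _ = Y⁻¹ * X * (Y * Y⁻¹) := by noncomm_ring
      _ = _ := by rw [mul_nonsing_inv _ (hu hY), mul_one]
  have cfg : Commute Sf Sg := hcomm
  have hAf : Commute A Sf := comm_of_sq hA (by
    rw [hAsq]; exact (Commute.refl Sf).mul_left (cinv hSg cfg).symm)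
  have hAg : Commute A Sg := comm_of_sq hA (by
    rw [hAsq]; exact cfg.mul_left (cinv hSg (Commute.refl Sg)).symm)
  have hBX : ∀ X, Commute X Sf → Commute X Sg → Commute X B := fun X h1 h2 =>
    (comm_of_sq hB (by rw [hBsq]; exact ((cinv hSf h1).mul_right (cinv hSg h2)).symm)).symm
  have hCX : ∀ X, Commute X Sf → Commute X Sg → Commute X C := fun X h1 h2 => by
    rw [hCdef]; exact commute_mcos ((hBX X h1 h2).smul_right t)
  have hSX : ∀ X, Commute X Sf → Commute X Sg → Commute X S := fun X h1 h2 => by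
    rw [hSdef]; exact commute_msin ((hBX X h1 h2).smul_right t)
  have hfC := hCX Sf (Commute.refl _) cfg
  have hgC := hCX Sg cfg.symm (Commute.refl _)
  have hfS := hSX Sf (Commute.refl _) cfg
  have hgS := hSX Sg cfg.symm (Commute.refl _)
  have hAC := hCX A hAf hAg
  have hAS := hSX A hAf hAg
  have hCS := hSX C hfC.symm hgC.symm
  have htB : (t • B).PosDef := hB.smul ht
  have hCS1 : C * C + S * S = 1 := by rw [hCdef, hSdef]; exact cos_sin_sq htB
  have hSt : Sᵀ = S := by rw [hSdef]; exact msin_transpose (tr htB)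
  have hCit : C⁻¹ᵀ = C⁻¹ := tr hCpos.inv
  have hCC : C * C⁻¹ = 1 := mul_nonsing_inv _ (hu hCpos)
  have hCC' : C⁻¹ * C = 1 := nonsing_inv_mul _ (hu hCpos)
  have hAA : A * A⁻¹ = 1 := mul_nonsing_inv _ (hu hA)
  have hfAA : Sf = A * A * Sg := by
    rw [hAsq, mul_assoc, nonsing_inv_mul _ (hu hSg), mul_one]
  have hSCi : Commute S C⁻¹ := cinv hCpos hCS.symm
  have hps : (A * S * C⁻¹ * Sg * (A * S * C⁻¹)ᵀ).PosSemidef := by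
    simpa using hSg.posSemidef.mul_mul_conjTranspose_same (A * S * C⁻¹)
  have hSig : C * (Sh + A * S * C⁻¹ * Sg * (A * S * C⁻¹)ᵀ) * C = Sf + C * (Sh - Sf) * C := by
    have e1 : C * (A * S * C⁻¹) = A * S := by
      rw [← mul_assoc, ← mul_assoc, ← hAC.eq, mul_assoc A, hCS.eq, mul_assoc A, mul_assoc S, hCC,
        mul_one]
    have e2 : (A * S * C⁻¹)ᵀ * C = S * A := by
      have := congrArg Matrix.transpose e1
      rw [transpose_mul, transpose_mul A, tr hCpos, tr hA, hSt] at this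
      exact this
    calc _ = C * Sh * C + (C * (A * S * C⁻¹)) * Sg * ((A * S * C⁻¹)ᵀ * C) := by noncomm_ring
      _ = C * Sh * C + A * (S * Sg) * (S * A) := by rw [e1, e2]; noncomm_ring
      _ = C * Sh * C + A * Sg * (S * (S * A)) := by rw [← hgS.eq]; noncomm_ring
      _ = C * Sh * C + A * Sg * A * (S * S) := by
        rw [← hAS.eq, ← mul_assoc S A, ← hAS.eq]; noncomm_ring
      _ = C * Sh * C + Sf * (S * S) := by rw [mul_assoc A Sg, ← hAg.eq, ← mul_assoc A A, ← hfAA]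
      _ = C * Sh * C + Sf * (1 - C * C) := by rw [← hCS1, add_sub_cancel_left]
      _ = C * Sh * C + Sf - Sf * C * C := by noncomm_ring
      _ = _ := by rw [hfC.eq]; noncomm_ring
  intro q
  set w := C⁻¹ *ᵥ (q - (μf + C *ᵥ (μh - μf))) with hw
  set c := -(A⁻¹ *ᵥ (S *ᵥ (q - μf))) - C *ᵥ μg with hc
  have hint : ∀ p, gaussPdf μh Sh (Q q p) * gaussPdf μg Sg (P q p)
      = (fun z => gaussPdf 0 Sh (w + (A * S * C⁻¹) *ᵥ z) * gaussPdf 0 Sg z) (C *ᵥ p + c) := by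
    intro p
    have e1 : P q p - μg = C *ᵥ p + c := by
      rw [hP, hc]; simp only [mulVec_sub]; abel
    have e2 : Q q p - μh = w + (A * S * C⁻¹) *ᵥ (C *ᵥ p + c) := by
      have hz : C *ᵥ p + c = C *ᵥ (p - μg) - A⁻¹ *ᵥ (S *ᵥ (q - μf)) := by
        rw [hc]; simp only [mulVec_sub]; abel
      have hw' : w = C⁻¹ *ᵥ (q - μf) - (μh - μf) := by
        rw [hw, ← sub_sub, mulVec_sub C⁻¹ (q - μf), mulVec_mulVec, hCC', one_mulVec]
      have m1 : A * S * C⁻¹ * C = A * S := by rw [mul_assoc, hCC', mul_one]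
      have m2 : A * S * C⁻¹ * (A⁻¹ * S) = C⁻¹ - C := by
        have hAiS : Commute S A⁻¹ := cinv hA hAS.symm
        have hACi : Commute A C⁻¹ := cinv hCpos hAC
        calc _ = A * (S * C⁻¹) * (S * A⁻¹) := by rw [hAiS.eq]; noncomm_ring
          _ = A * C⁻¹ * (S * S) * A⁻¹ := by rw [hSCi.eq]; noncomm_ring
          _ = C⁻¹ * A * ((S * S) * A⁻¹) := by rw [hACi.eq]; noncomm_ring
          _ = C⁻¹ * (A * A⁻¹) * (S * S) := by
            rw [(hAiS.mul_left hAiS).eq]; noncomm_ring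
          _ = C⁻¹ * (1 - C * C) := by rw [hAA, mul_one, ← hCS1, add_sub_cancel_left]
          _ = C⁻¹ - (C⁻¹ * C) * C := by noncomm_ring
          _ = _ := by rw [hCC', one_mul]
      have hQq : Q q p = μf + C *ᵥ (q - μf) + A *ᵥ (S *ᵥ (p - μg)) := by rw [hQ]
      rw [hQq, hz, hw', mulVec_sub (A * S * C⁻¹), mulVec_mulVec _ _ C, m1, mulVec_mulVec _ A⁻¹ S,
        mulVec_mulVec _ _ (A⁻¹ * S), m2, sub_mulVec, ← mulVec_mulVec]
      abel
    rw [gaussPdf_sub μh, gaussPdf_sub μg, e1, e2]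
  simp_rw [hint]
  rw [integral_comp_mulVec hCpos.det_pos.ne' (fun y => (fun z =>
    gaussPdf 0 Sh (w + (A * S * C⁻¹) *ᵥ z) * gaussPdf 0 Sg z) (y + c)),
    integral_add_right_eq_self (fun z =>
    gaussPdf 0 Sh (w + (A * S * C⁻¹) *ᵥ z) * gaussPdf 0 Sg z) c,
    gauss_conv hSh hSg, hw, gauss_scale hCpos (hSh.add_posSemidef hps), hSig, ← gaussPdf_sub]
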